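/- Let E : M(Γ) → ℝ ∪ {+∞} be weak-* lower semicontinuous, and for each n let P_n ⊆ Γ be a subset with indicator penalty χ_{P_n} (equal to 0 on measures supported in P_n and +∞ otherwise). Suppose: (i) ∪_n P_n is dense in Γ; (ii) for every γ ∈ Γ there exist approximations γⁿ ∈ P_n with γⁿ → γ uniformly and w(γⁿ) ≤ w(γ), where E(σ) = D(σ) + ∫_Γ w dσ with D weak-* continuous. Then the functionals E_n = E + χ_{P_n} Γ-converge to E with respect to weak-* convergence of measures. -/

import Mathlib

open MeasureTheory Filter Topology
open scoped ENNReal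

/-- Every metric space is an increasing union of closed sets, each of which is partitioned by the
fibres of a map `a` that is `ε`-close to the identity; the fibres are uniformly separated, so any
union of them is closed. -/
lemma exists_separated_closed_exhaustion {X : Type*} [MetricSpace X] {ε : ℝ} (hε : 0 < ε) :
    ∃ (a : X → X) (G : ℕ → Set X), Monotone G ∧ (⋃ j, G j) = Set.univ ∧
      (∀ x, dist x (a x) < ε) ∧
      (∀ j, ∀ x ∈ G j, ∀ y ∈ G j, a x ≠ a y → 1 / ((j : ℝ) + 1) ≤ dist x y) ∧
      ∀ j C, IsClosed (G j ∩ a ⁻¹' C) := by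
  classical
  obtain ⟨_, _⟩ := exists_wellFoundedLT X
  have hne (x : X) : {c | dist x c < ε}.Nonempty := ⟨x, by simpa using hε⟩
  let a (x : X) : X := wellFounded_lt.min {c | dist x c < ε} (hne x)
  have ha (x : X) : dist x (a x) < ε := wellFounded_lt.min_mem {c | dist x c < ε} (hne x)
  have hmin (x c : X) (h : dist x c < ε) : a x ≤ c :=
    not_lt.1 (wellFounded_lt.not_lt_min {c | dist x c < ε} h)
  let G (j : ℕ) : Set X := {x | dist x (a x) ≤ ε - 1 / ((j : ℝ) + 1)}
  have key (j : ℕ) (x y : X) (hx : x ∈ G j) (h : a x < a y) :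
      1 / ((j : ℝ) + 1) ≤ dist x y := by
    have h1 : ε ≤ dist y (a x) := by
      by_contra! hlt
      exact absurd (hmin y _ hlt) (not_le.2 h)
    have h2 : dist x (a x) ≤ ε - 1 / ((j : ℝ) + 1) := hx
    linarith [dist_triangle_left y (a x) x]
  have hsep (j : ℕ) : ∀ x ∈ G j, ∀ y ∈ G j, a x ≠ a y → 1 / ((j : ℝ) + 1) ≤ dist x y := by
    intro x hx y hy hxy
    rcases lt_or_gt_of_ne hxy with h | h
    · exact key j x y hx h
    · rw [dist_comm]
      exact key j y x hy h
  refine ⟨a, G, ?_, ?_, ha, hsep, ?_⟩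
  · intro i j hij x hx
    have h1 : 1 / ((j : ℝ) + 1) ≤ 1 / ((i : ℝ) + 1) := Nat.one_div_le_one_div hij
    have h2 : dist x (a x) ≤ ε - 1 / ((i : ℝ) + 1) := hx
    show dist x (a x) ≤ _
    linarith
  · refine Set.eq_univ_of_forall fun x => Set.mem_iUnion.2 ?_
    obtain ⟨j, hj⟩ := exists_nat_one_div_lt (sub_pos.2 (ha x))
    refine ⟨j, ?_⟩
    show dist x (a x) ≤ _
    linarith
  · intro j C
    refine isClosed_of_closure_subset fun x hx => ?_
    rw [Metric.mem_closure_iff] at hx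
    have hpos : 0 < 1 / ((j : ℝ) + 1) := Nat.one_div_pos_of_nat
    obtain ⟨y₀, ⟨hy₀, hC⟩, hxy₀⟩ := hx (1 / ((j : ℝ) + 1) / 2) (half_pos hpos)
    have happrox (r : ℝ) (hr : 0 < r) : ∃ y ∈ G j, a y = a y₀ ∧ dist x y < r := by
      obtain ⟨y, ⟨hy, -⟩, hxy⟩ := hx (min r (1 / ((j : ℝ) + 1) / 2)) (lt_min hr (half_pos hpos))
      refine ⟨y, hy, ?_, hxy.trans_le (min_le_left _ _)⟩
      by_contra hne
      have h1 := hsep j y hy y₀ hy₀ hne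
      have h2 := hxy.trans_le (min_le_right _ _)
      linarith [dist_triangle_left y y₀ x]
    have hle : dist x (a y₀) ≤ ε - 1 / ((j : ℝ) + 1) := by
      refine le_of_forall_pos_le_add fun r hr => ?_
      obtain ⟨y, hy, hay, hxy⟩ := happrox r hr
      have h1 : dist y (a y) ≤ ε - 1 / ((j : ℝ) + 1) := hy
      rw [hay] at h1
      linarith [dist_triangle x y (a y₀)]
    have hax : a x = a y₀ := by
      refine le_antisymm (hmin x _ (by linarith)) ?_
      obtain ⟨y, hy, hay, hxy⟩ := happrox (ε - dist x (a x)) (sub_pos.2 (ha x))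
      rw [← hay]
      exact hmin y _ (by linarith [dist_triangle_left y (a x) x])
    refine ⟨?_, ?_⟩
    · show dist x (a x) ≤ _
      rwa [hax]
    · show a x ∈ C
      rwa [hax]

lemma exists_mem_forall_le_add {X : Type*} (w : X → ℝ≥0∞) {A : Set X} (hA : A.Nonempty)
    {δ : ℝ≥0∞} (hδ : δ ≠ 0) : ∃ x ∈ A, ∀ y ∈ A, w x ≤ w y + δ := by
  by_cases h : sInf (w '' A) = ⊤
  · obtain ⟨x, hx⟩ := hA
    refine ⟨x, hx, fun y hy => ?_⟩
    have : w y = ⊤ := top_le_iff.1 (h ▸ sInf_le (Set.mem_image_of_mem w hy))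
    simp [this]
  · obtain ⟨_, ⟨x, hx, rfl⟩, hlt⟩ := sInf_lt_iff.1 (ENNReal.lt_add_right h hδ)
    exact ⟨x, hx, fun y hy => hlt.le.trans <| by
      gcongr
      exact sInf_le (Set.mem_image_of_mem w hy)⟩

lemma exists_measure_compl_lt_of_monotone {X : Type*} [MeasurableSpace X] (μ : Measure X)
    [IsFiniteMeasure μ] {G : ℕ → Set X} (hmono : Monotone G) (hG : ∀ j, MeasurableSet (G j))
    (hU : (⋃ j, G j) = Set.univ) {δ : ℝ≥0∞} (hδ : δ ≠ 0) : ∃ j, μ (G j)ᶜ < δ := by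
  have h := tendsto_measure_iInter_atTop (μ := μ) (s := fun j => (G j)ᶜ)
    (fun j => (hG j).compl.nullMeasurableSet)
    (fun i j hij => Set.compl_subset_compl.2 (hmono hij)) ⟨0, measure_ne_top _ _⟩
  rw [← Set.compl_iUnion, hU, Set.compl_univ, measure_empty] at h
  exact (h.eventually_lt_const (pos_iff_ne_zero.2 hδ)).exists

/-- If `S n` converges pointwise to the identity and does not increase `w`, then off a set of small
measure `S n` can be replaced, for all large `n`, by a measurable map with measurable image. -/
lemma exists_approx_with_measurable_image {X : Type*} [MetricSpace X] [MeasurableSpace X]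
    [BorelSpace X] (μ : Measure X) [IsFiniteMeasure μ] (w : X → ℝ≥0∞) (P : ℕ → Set X)
    (S : ℕ → X → X) (hSP : ∀ n x, S n x ∈ P n)
    (hSconv : ∀ x, Tendsto (fun n => S n x) atTop (𝓝 x)) (hSw : ∀ n x, w (S n x) ≤ w x)
    {ε : ℝ} (hε : 0 < ε) {δ : ℝ≥0∞} (hδ : δ ≠ 0) :
    ∃ H : Set X, MeasurableSet H ∧ μ Hᶜ ≤ δ ∧ ∃ N, ∀ n ≥ N, ∃ T : X → X,
      Measurable T ∧ MeasurableSet (T '' H) ∧ T '' H ⊆ P n ∧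
      ∀ x ∈ H, dist (T x) x ≤ ε ∧ w (T x) ≤ w x + δ := by
  classical
  obtain ⟨a, G, hmono, hU, ha, hsep, hclosed⟩ :=
    exists_separated_closed_exhaustion (X := X) (show 0 < ε / 3 by positivity)
  have hGmeas (j : ℕ) : MeasurableSet (G j) := by
    simpa using (hclosed j Set.univ).measurableSet
  have hδ2 : δ / 2 ≠ 0 := by simp [hδ]
  obtain ⟨j, hj⟩ := exists_measure_compl_lt_of_monotone μ hmono hGmeas hU hδ2
  have hrep (c : X) : ∃ r : X, (G j ∩ a ⁻¹' {c}).Nonempty →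
      r ∈ G j ∩ a ⁻¹' {c} ∧ ∀ y ∈ G j ∩ a ⁻¹' {c}, w r ≤ w y + δ := by
    by_cases h : (G j ∩ a ⁻¹' {c}).Nonempty
    · obtain ⟨r, hr, hrw⟩ := exists_mem_forall_le_add w h hδ
      exact ⟨r, fun _ => ⟨hr, hrw⟩⟩
    · exact ⟨c, fun h' => absurd h' h⟩
  choose r hr using hrep
  have hr' (x : X) (hx : x ∈ G j) :
      r (a x) ∈ G j ∧ a (r (a x)) = a x ∧ w (r (a x)) ≤ w x + δ := by
    obtain ⟨⟨h1, h2⟩, h3⟩ := hr (a x) ⟨x, hx, rfl⟩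
    exact ⟨h1, h2, h3 x ⟨hx, rfl⟩⟩
  have hpos : 0 < 1 / ((j : ℝ) + 1) := Nat.one_div_pos_of_nat
  set s : ℝ := 1 / ((j : ℝ) + 1)
  let C (N : ℕ) : Set X := {c | ∀ n ≥ N, dist (S n (r c)) (r c) ≤ min (ε / 3) (s / 3)}
  have hHmeas (N : ℕ) (B : Set X) : MeasurableSet (G j ∩ a ⁻¹' B) := (hclosed j B).measurableSet
  obtain ⟨N, hN⟩ := exists_measure_compl_lt_of_monotone μ
    (G := fun N => (G j ∩ a ⁻¹' C N) ∪ (G j)ᶜ)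
    (fun M N hMN => Set.union_subset_union_left _ <| Set.inter_subset_inter_right _ <|
      Set.preimage_mono fun c hc n hn => hc n (hMN.trans hn))
    (fun N => (hHmeas N _).union (hGmeas j).compl)
    (by
      refine Set.eq_univ_of_forall fun x => Set.mem_iUnion.2 ?_
      obtain ⟨N, hN⟩ := Metric.tendsto_atTop.1 (hSconv (r (a x))) (min (ε / 3) (s / 3))
        (lt_min (by positivity) (by positivity))
      by_cases hx : x ∈ G j
      · exact ⟨N, Or.inl ⟨hx, fun n hn => (hN n hn).le⟩⟩
      · exact ⟨N, Or.inr hx⟩) hδ2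
  refine ⟨G j ∩ a ⁻¹' C N, hHmeas N _, ?_, N, fun n hn => ?_⟩
  · calc μ (G j ∩ a ⁻¹' C N)ᶜ ≤ μ ((G j)ᶜ ∪ ((G j ∩ a ⁻¹' C N) ∪ (G j)ᶜ)ᶜ) := by
          refine measure_mono fun x hx => ?_
          simp only [Set.mem_union, Set.mem_compl_iff] at hx ⊢
          tauto
      _ ≤ μ (G j)ᶜ + μ ((G j ∩ a ⁻¹' C N) ∪ (G j)ᶜ)ᶜ := measure_union_le _ _
      _ ≤ δ / 2 + δ / 2 := add_le_add hj.le hN.le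
      _ = δ := ENNReal.add_halves δ
  · set H := G j ∩ a ⁻¹' C N
    have hH : MeasurableSet H := hHmeas N _
    let T (x : X) : X := if x ∈ H then S n (r (a x)) else x
    have hT (x : X) (hx : x ∈ H) : T x = S n (r (a x)) := if_pos hx
    have hclose (x : X) (hx : x ∈ H) : dist (T x) (r (a x)) ≤ min (ε / 3) (s / 3) := by
      rw [hT x hx]
      exact hx.2 n hn
    refine ⟨T, ?_, ?_, ?_, ?_⟩
    · intro B hB
      have : T ⁻¹' B = (G j ∩ a ⁻¹' (C N ∩ {c | S n (r c) ∈ B})) ∪ (Hᶜ ∩ B) := by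
        ext x
        by_cases hx : x ∈ H
        · have h1 : x ∈ G j := hx.1
          have h2 : a x ∈ C N := hx.2
          simp [hT x hx, hx, h1, h2]
        · have h1 : ¬ (x ∈ G j ∧ a x ∈ C N) := hx
          have h2 : T x = x := if_neg hx
          simp only [Set.mem_preimage, h2, Set.mem_union, Set.mem_inter_iff, Set.mem_compl_iff,
            Set.mem_ofPred_eq]
          tauto
      rw [this]
      exact (hHmeas N _).union (hH.compl.inter hB)
    · refine (Metric.isClosed_of_pairwise_le_dist (ε := s / 3) (by positivity) ?_).measurableSet
      rintro _ ⟨x, hx, rfl⟩ _ ⟨y, hy, rfl⟩ hne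
      have hay : a x ≠ a y := fun h => hne (by rw [hT x hx, hT y hy, h])
      obtain ⟨hx1, hx2, -⟩ := hr' x hx.1
      obtain ⟨hy1, hy2, -⟩ := hr' y hy.1
      have h1 := hsep j _ hx1 _ hy1 (by rwa [hx2, hy2])
      have h2 := (hclose x hx).trans (min_le_right _ _)
      have h3 := (hclose y hy).trans (min_le_right _ _)
      have h4 := dist_triangle4 (r (a x)) (T x) (T y) (r (a y))
      rw [dist_comm (r (a x)) (T x)] at h4
      change s ≤ _ at h1
      linarith
    · rintro _ ⟨x, hx, rfl⟩
      rw [hT x hx]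
      exact hSP n _
    · intro x hx
      obtain ⟨-, hx2, hx3⟩ := hr' x hx.1
      refine ⟨?_, ?_⟩
      · have h1 := (hclose x hx).trans (min_le_left _ _)
        have h2 := ha x
        have h3 := ha (r (a x))
        rw [hx2] at h3
        have h4 := dist_triangle4 (T x) (r (a x)) (a x) x
        rw [dist_comm (a x) x] at h4
        linarith
      · rw [hT x hx]
        exact (hSw n _).trans hx3

lemma exists_tendsto_atTop_eventually_le (N : ℕ → ℕ) :
    ∃ k : ℕ → ℕ, Tendsto k atTop atTop ∧ ∀ᶠ n in atTop, N (k n) ≤ n := by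
  refine ⟨fun n => Nat.findGreatest (fun k => N k ≤ n) n, ?_, ?_⟩
  · refine tendsto_atTop.2 fun b => ?_
    filter_upwards [eventually_ge_atTop b, eventually_ge_atTop (N b)] with n h1 h2
    exact Nat.le_findGreatest h1 h2
  · filter_upwards [eventually_ge_atTop (N 0)] with n hn
    exact Nat.findGreatest_spec (P := fun k => N k ≤ n) (Nat.zero_le n) hn

lemma tendsto_map_restrict_of_ae_tendsto {X : Type*} [MetricSpace X] [MeasurableSpace X]
    [BorelSpace X] (σ : FiniteMeasure X) {H : ℕ → Set X} {T : ℕ → X → X}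
    (hH : ∀ n, MeasurableSet (H n)) (hT : ∀ n, Measurable (T n))
    (hmem : ∀ᵐ x ∂(σ : Measure X), ∀ᶠ n in atTop, x ∈ H n)
    (hlim : ∀ᵐ x ∂(σ : Measure X), Tendsto (fun n => T n x) atTop (𝓝 x)) :
    Tendsto (fun n => (σ.restrict (H n)).map (T n)) atTop (𝓝 σ) := by
  rw [FiniteMeasure.tendsto_iff_forall_integral_tendsto]
  intro f
  have heq (n : ℕ) : ∫ x, f x ∂((σ.restrict (H n)).map (T n) : Measure X) =
      ∫ x, (H n).indicator (fun x => f (T n x)) x ∂(σ : Measure X) := by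
    rw [integral_indicator (hH n), FiniteMeasure.toMeasure_map,
      FiniteMeasure.restrict_measure_eq,
      integral_map (hT n).aemeasurable f.continuous.stronglyMeasurable.aestronglyMeasurable]
  simp only [heq]
  refine tendsto_integral_of_dominated_convergence (fun _ => ‖f‖) (fun n => ?_)
    (integrable_const _) (fun n => ae_of_all _ fun x => ?_) ?_
  · exact ((f.continuous.measurable.comp (hT n)).indicator (hH n)).aestronglyMeasurable
  · exact (norm_indicator_le_norm_self _ _).trans (f.norm_coe_le_norm _)
  · filter_upwards [hmem, hlim] with x h1 h2
    refine ((f.continuous.tendsto x).comp h2).congr' ?_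
    filter_upwards [h1] with n hn
    simp [hn]


/-- Γ-convergence of the discretised energies E_n = E + χ_{P_n} to
E(σ) = D(σ) + ∫ w dσ with respect to weak-* convergence of measures,
under density of ∪ P_n and the existence of energy-decreasing uniform
approximations in P_n. -/
theorem gamma_convergence_discretisation
    {Γ : Type*} [MetricSpace Γ] [MeasurableSpace Γ] [BorelSpace Γ]
    (D : FiniteMeasure Γ → ℝ≥0∞) (hD : Continuous D)
    (w : Γ → ℝ≥0∞) (hw : LowerSemicontinuous w)
    (E : FiniteMeasure Γ → ℝ≥0∞)
    (hE : ∀ σ : FiniteMeasure Γ, E σ = D σ + ∫⁻ γ, w γ ∂(σ : Measure Γ))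
    (hElsc : LowerSemicontinuous E)
    (P : ℕ → Set Γ) (hdense : Dense (⋃ n, P n))
    (S : ℕ → Γ → Γ) (hSmeas : ∀ n, Measurable (S n))
    (hSP : ∀ n γ, S n γ ∈ P n)
    (hSconv : ∀ γ : Γ, Tendsto (fun n => S n γ) atTop (𝓝 γ))
    (hSw : ∀ n (γ : Γ), w (S n γ) ≤ w γ) :
    (∀ (σ : FiniteMeasure Γ) (σs : ℕ → FiniteMeasure Γ), Tendsto σs atTop (𝓝 σ) →
      E σ ≤ atTop.liminf (fun n =>
        E (σs n) + (if (σs n : Measure Γ) (P n)ᶜ = 0 then 0 else ⊤))) ∧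
    (∀ σ : FiniteMeasure Γ, ∃ σs : ℕ → FiniteMeasure Γ, Tendsto σs atTop (𝓝 σ) ∧
      atTop.limsup (fun n =>
        E (σs n) + (if (σs n : Measure Γ) (P n)ᶜ = 0 then 0 else ⊤)) ≤ E σ) := by
  refine ⟨fun σ σs hσ => ?_, fun σ => ?_⟩
  · refine le_of_forall_lt fun y hy => ?_
    obtain ⟨z, hyz, hz⟩ := exists_between hy
    refine hyz.trans_le (le_liminf_of_le (by isBoundedDefault) ?_)
    filter_upwards [hσ.eventually (hElsc σ z hz)] with n hn
    exact hn.le.trans le_self_add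
  · have hpow (k : ℕ) : ((2 : ℝ≥0∞)⁻¹ ^ k) ≠ 0 := by simp
    choose H hHmeas hHσ N hN using fun k : ℕ =>
      exists_approx_with_measurable_image (σ : Measure Γ) w P S hSP hSconv hSw
        (ε := 1 / ((k : ℝ) + 1)) Nat.one_div_pos_of_nat (hpow k)
    obtain ⟨k, hk, hNk⟩ := exists_tendsto_atTop_eventually_le N
    have hT (n : ℕ) : ∃ T : Γ → Γ, Measurable T ∧ (N (k n) ≤ n →
        MeasurableSet (T '' H (k n)) ∧ T '' H (k n) ⊆ P n ∧ ∀ x ∈ H (k n),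
          dist (T x) x ≤ 1 / ((k n : ℝ) + 1) ∧ w (T x) ≤ w x + 2⁻¹ ^ k n) := by
      by_cases h : N (k n) ≤ n
      · obtain ⟨T, hT, hT'⟩ := hN (k n) n h
        exact ⟨T, hT, fun _ => hT'⟩
      · exact ⟨id, measurable_id, fun h' => absurd h' h⟩
    choose T hTmeas hT using hT
    have hmem : ∀ᵐ x ∂(σ : Measure Γ), ∀ᶠ n in atTop, x ∈ H (k n) := by
      have hsum : ∑' i, (σ : Measure Γ) (H i)ᶜ ≠ ⊤ := by
        refine ne_top_of_le_ne_top ?_ (ENNReal.tsum_le_tsum hHσ)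
        simp [ENNReal.tsum_geometric]
      filter_upwards [ae_eventually_notMem hsum] with x hx
      filter_upwards [hk.eventually hx] with n hn
      simpa using hn
    have hlim : ∀ᵐ x ∂(σ : Measure Γ), Tendsto (fun n => T n x) atTop (𝓝 x) := by
      filter_upwards [hmem] with x hx
      refine tendsto_iff_dist_tendsto_zero.2 ?_
      refine squeeze_zero' (Eventually.of_forall fun n => dist_nonneg) ?_
        (tendsto_one_div_add_atTop_nhds_zero_nat.comp hk)
      filter_upwards [hx, hNk] with n h1 h2
      exact ((hT n h2).2.2 x h1).1
    have hconv := tendsto_map_restrict_of_ae_tendsto σ (fun n => hHmeas (k n)) hTmeas hmem hlim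
    refine ⟨_, hconv, ?_⟩
    have hbound : Tendsto (fun n => D ((σ.restrict (H (k n))).map (T n)) +
        (∫⁻ x, w x ∂(σ : Measure Γ) + 2⁻¹ ^ k n * (σ : Measure Γ) Set.univ)) atTop
        (𝓝 (E σ)) := by
      have h1 : Tendsto (fun n => (2 : ℝ≥0∞)⁻¹ ^ k n * (σ : Measure Γ) Set.univ) atTop (𝓝 0) := by
        have h2 : Tendsto (fun n => (2 : ℝ≥0∞)⁻¹ ^ k n) atTop (𝓝 0) :=
          (ENNReal.tendsto_pow_atTop_nhds_zero_of_lt_one (by simp)).comp hk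
        simpa using ENNReal.Tendsto.mul_const h2 (Or.inr (measure_ne_top (σ : Measure Γ) _))
      have h3 := ((hD.tendsto σ).comp hconv).add
        ((tendsto_const_nhds (x := ∫⁻ x, w x ∂(σ : Measure Γ))).add h1)
      rw [add_zero, ← hE] at h3
      exact h3
    rw [← hbound.limsup_eq]
    refine limsup_le_limsup ?_ (by isBoundedDefault) (by isBoundedDefault)
    filter_upwards [hNk] with n hn
    obtain ⟨himg, hsub, hTx⟩ := hT n hn
    have hnull : ((σ.restrict (H (k n))).map (T n) : Measure Γ) (P n)ᶜ = 0 := by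
      refine measure_mono_null (Set.compl_subset_compl.2 hsub) ?_
      rw [FiniteMeasure.toMeasure_map, FiniteMeasure.restrict_measure_eq,
        Measure.map_apply (hTmeas n) himg.compl,
        Measure.restrict_apply (hTmeas n himg.compl)]
      refine measure_mono_null (fun x hx => ?_) (measure_empty (μ := (σ : Measure Γ)))
      exact hx.1 ⟨x, hx.2, rfl⟩
    rw [if_pos hnull, add_zero, hE, FiniteMeasure.toMeasure_map,
      FiniteMeasure.restrict_measure_eq, lintegral_map hw.measurable (hTmeas n)]
    gcongr
    calc ∫⁻ x in H (k n), w (T n x) ∂(σ : Measure Γ)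
        ≤ ∫⁻ x in H (k n), (w x + 2⁻¹ ^ k n) ∂(σ : Measure Γ) :=
          setLIntegral_mono (hw.measurable.add_const _) fun x hx => (hTx x hx).2
      _ ≤ ∫⁻ x, (w x + 2⁻¹ ^ k n) ∂(σ : Measure Γ) := setLIntegral_le_lintegral _ _
      _ = _ := by rw [lintegral_add_right _ measurable_const, lintegral_const]
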